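/- Let N ≥ 1, α ∈ ℝ, R > 0, and let g : ℂ^N → ℂ be holomorphic. Define Ψ₊(x) := exp(−α Σ_{1≤j<k≤N} w_R(x_j − x_k)) · conj(g(z₁,…,z_N)) and Ψ₋(x) := exp(+α Σ_{1≤j<k≤N} w_R(x_j − x_k)) · g(z₁,…,z_N). Then at every configuration x ∈ (ℝ²)^N such that |x_j − x_k| ≠ R for all j < k, one has Σ_{j=1}^N D_j² Ψ₊(x) = +α W_R(x) Ψ₊(x) and Σ_{j=1}^N D_j² Ψ₋(x) = −α W_R(x) Ψ₋(x), where D_j := −i∇_{x_j} + α A_j^R(x). -/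

import Mathlib

open MeasureTheory Finset
open scoped BigOperators ComplexConjugate

noncomputable section

/-- Configuration space of `N` particles in the plane. -/
abbrev Conf (N : ℕ) := Fin N → Fin 2 → ℝ

/-- Euclidean norm of a planar vector. -/
def nrm (v : Fin 2 → ℝ) : ℝ := Real.sqrt (v 0 ^ 2 + v 1 ^ 2)

/-- Counterclockwise 90°-rotation `x^⊥ = (-x₂, x₁)`. -/
def perp (v : Fin 2 → ℝ) : Fin 2 → ℝ := ![-(v 1), v 0]

/-- Complex coordinate `z = x₁ + i x₂` of a planar point. -/
def zC (v : Fin 2 → ℝ) : ℂ := (v 0 : ℂ) + (v 1 : ℂ) * Complex.I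

/-- Standard basis vector labelled `(j,i)` of the configuration space. -/
def evec {N : ℕ} (j : Fin N) (i : Fin 2) : Conf N :=
  fun j' i' => if j' = j ∧ i' = i then 1 else 0

/-- Partial derivative in the variable `(j,i)` of a complex-valued function. -/
def pd {N : ℕ} (j : Fin N) (i : Fin 2) (f : Conf N → ℂ) (x : Conf N) : ℂ :=
  fderiv ℝ f x (evec j i)

/-- Partial derivative in the variable `(j,i)` of a real-valued function. -/
def pdR {N : ℕ} (j : Fin N) (i : Fin 2) (f : Conf N → ℝ) (x : Conf N) : ℝ :=
  fderiv ℝ f x (evec j i)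

/-- Ideal anyon magnetic potential `A_j(x) = Σ_{k≠j} (x_j - x_k)^{-⊥}`. -/
def Avec {N : ℕ} (j : Fin N) (x : Conf N) : Fin 2 → ℝ :=
  ∑ k ∈ univ.filter (fun k => k ≠ j), (1 / nrm (x j - x k) ^ 2) • perp (x j - x k)

/-- Component `i` of the magnetically coupled momentum `D_j = -i∇_j + αA_j`. -/
def Dop {N : ℕ} (α : ℝ) (j : Fin N) (i : Fin 2) (f : Conf N → ℂ) (x : Conf N) : ℂ :=
  (-Complex.I) * pd j i f x + ((α * Avec j x i : ℝ) : ℂ) * f x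

/-- The magnetic Laplacian `D_j² = D_j · D_j`. -/
def D2 {N : ℕ} (α : ℝ) (j : Fin N) (f : Conf N → ℂ) (x : Conf N) : ℂ :=
  ∑ i : Fin 2, Dop α j i (fun y => Dop α j i f y) x

/-- The fat diagonal of the configuration space. -/
def fatDiag (N : ℕ) : Set (Conf N) := {x | ∃ j k, j ≠ k ∧ x j = x k}


/-- Regularized superpotential `w_R`. -/
def wR (R : ℝ) (v : Fin 2 → ℝ) : ℝ :=
  if R < nrm v then Real.log (nrm v) else Real.log R + (nrm v ^ 2 / R ^ 2 - 1) / 2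

/-- `R`-extended anyon magnetic potential `A_j^R(x) = Σ_{k≠j} (x_j-x_k)^⊥/|x_j-x_k|_R²`. -/
def AvecR {N : ℕ} (R : ℝ) (j : Fin N) (x : Conf N) : Fin 2 → ℝ :=
  ∑ k ∈ univ.filter (fun k => k ≠ j),
    (1 / max (nrm (x j - x k)) R ^ 2) • perp (x j - x k)

/-- Component `i` of the `R`-extended magnetically coupled momentum `D_j = -i∇_j + αA_j^R`. -/
def DopR {N : ℕ} (α R : ℝ) (j : Fin N) (i : Fin 2) (f : Conf N → ℂ) (x : Conf N) : ℂ :=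
  (-Complex.I) * pd j i f x + ((α * AvecR R j x i : ℝ) : ℂ) * f x

/-- The `R`-extended magnetic Laplacian `D_j² = D_j · D_j`. -/
def D2R {N : ℕ} (α R : ℝ) (j : Fin N) (f : Conf N → ℂ) (x : Conf N) : ℂ :=
  ∑ i : Fin 2, DopR α R j i (fun y => DopR α R j i f y) x

/-- `W_R(x) = Σ_{j≠k} (2/R²)·1_{|x_j-x_k|<R}`. -/
def WR {N : ℕ} (R : ℝ) (x : Conf N) : ℝ :=
  ∑ p ∈ univ.filter (fun p : Fin N × Fin N => p.1 ≠ p.2),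
    (2 / R ^ 2) * (if nrm (x p.1 - x p.2) < R then 1 else 0)

theorem aux_fderiv_diff {N : ℕ} (g : (Fin N → ℂ) → ℂ) (hg : Differentiable ℂ g)
    (v : Fin N → ℂ) : Differentiable ℂ (fun y => fderiv ℂ g y v) := by
  have key : ∀ y, fderiv ℂ g y v = (2 * Real.pi * Complex.I : ℂ)⁻¹ •
      ∫ θ : ℝ in (0:ℝ)..(2 * Real.pi), (deriv (circleMap 0 1) θ *
        (1 / (circleMap 0 1 θ - 0) ^ 2)) * g (y + circleMap 0 1 θ • v) := by
    intro y
    have hd : Differentiable ℂ (fun ζ : ℂ => g (y + ζ • v)) := by fun_prop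
    have h1 := (hd.differentiableOn (s := Metric.closedBall 0 1)).deriv_eq_smul_circleIntegral
      one_pos
    have h2 : HasDerivAt (fun ζ : ℂ => g (y + ζ • v)) (fderiv ℂ g y v) 0 := by
      have h3 : HasDerivAt (fun ζ : ℂ => y + ζ • v) v 0 := by
        simpa using ((hasDerivAt_id (0:ℂ)).smul_const v).const_add y
      have h4 : HasFDerivAt g (fderiv ℂ g y) (y + (0:ℂ) • v) := by
        simpa using (hg y).hasFDerivAt
      exact h4.comp_hasDerivAt (0:ℂ) h3
    rw [h2.deriv] at h1
    have h5 : (2 * Real.pi * Complex.I : ℂ) ≠ 0 := Complex.two_pi_I_ne_zero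
    rw [← inv_smul_eq_iff₀ h5] at h1
    rw [← h1]
    unfold circleIntegral
    simp only [smul_eq_mul, mul_assoc]
  have : (fun y => fderiv ℂ g y v) = fun y => (2 * Real.pi * Complex.I : ℂ)⁻¹ •
      ∫ θ : ℝ in (0:ℝ)..(2 * Real.pi), (deriv (circleMap 0 1) θ *
        (1 / (circleMap 0 1 θ - 0) ^ 2)) * g (y + circleMap 0 1 θ • v) := funext key
  rw [this]
  intro x₀
  refine DifferentiableAt.fun_const_smul (R := ℂ) ?_ ((2 * Real.pi * Complex.I : ℂ)⁻¹)
  obtain ⟨M, hM⟩ := (isCompact_closedBall x₀ (3 + ‖v‖)).exists_bound_of_continuousOn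
    hg.continuous.continuousOn
  have hb : ∀ y ∈ Metric.closedBall x₀ (1 + ‖v‖), ‖fderiv ℂ g y‖ ≤ 2 * M / 1 := by
    intro y hy
    refine Complex.norm_fderiv_le_div_of_mapsTo_ball hg.differentiableOn ?_ one_pos
    intro z hz
    simp only [Metric.mem_ball, Metric.mem_closedBall] at *
    have a1 := hM z (by
      have := dist_triangle z y x₀
      linarith)
    have a2 := hM y (by linarith)
    rw [dist_eq_norm]
    have := norm_sub_le (g z) (g y)
    linarith
  have hc : Continuous (circleMap 0 1) := continuous_circleMap 0 1
  have hcn : ∀ θ, circleMap 0 1 θ ≠ 0 := fun θ => circleMap_ne_center one_ne_zero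
  have hcc : Continuous (fun θ => deriv (circleMap 0 1) θ * (1 / (circleMap 0 1 θ - 0) ^ 2)) := by
    simp only [deriv_circleMap, sub_zero]
    refine (hc.mul continuous_const).mul (continuous_const.div (hc.pow 2) ?_)
    intro θ; exact pow_ne_zero _ (hcn θ)
  have hgc : Continuous g := hg.continuous
  have hF : ∀ y, Continuous (fun θ => (deriv (circleMap 0 1) θ *
        (1 / (circleMap 0 1 θ - 0) ^ 2)) * g (y + circleMap 0 1 θ • v)) := by
    intro y
    exact hcc.mul (by fun_prop)
  refine (intervalIntegral.hasFDerivAt_integral_of_dominated_of_fderiv_le (𝕜 := ℂ)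
    (F' := fun y θ => (deriv (circleMap 0 1) θ * (1 / (circleMap 0 1 θ - 0) ^ 2)) •
      fderiv ℂ g (y + circleMap 0 1 θ • v)) (bound := fun _ => 2 * M / 1)
    (Metric.ball_mem_nhds x₀ one_pos) ?_ ?_ ?_ ?_ ?_ ?_).differentiableAt
  · exact Filter.Eventually.of_forall fun y => (hF y).aestronglyMeasurable
  · exact (hF x₀).intervalIntegrable _ _
  · refine AEStronglyMeasurable.smul hcc.aestronglyMeasurable ?_
    have hm : Measurable (fun θ : ℝ => x₀ + circleMap 0 1 θ • v) := by
      have : Continuous (fun θ : ℝ => x₀ + circleMap 0 1 θ • v) := by fun_prop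
      exact this.measurable
    exact ((measurable_fderiv ℂ g).comp hm).aestronglyMeasurable
  · refine Filter.Eventually.of_forall fun θ _ y hy => ?_
    rw [norm_smul]
    have h1 : ‖deriv (circleMap 0 1) θ * (1 / (circleMap 0 1 θ - 0) ^ 2)‖ = 1 := by
      simp [deriv_circleMap]
    rw [h1, one_mul]
    apply hb
    simp only [Metric.mem_ball, Metric.mem_closedBall, dist_eq_norm] at *
    have : ‖circleMap 0 1 θ • v‖ = ‖v‖ := by rw [norm_smul]; simp
    have h2 := norm_add_le (y - x₀) (circleMap 0 1 θ • v)
    rw [show y + circleMap 0 1 θ • v - x₀ = y - x₀ + circleMap 0 1 θ • v by abel]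
    linarith
  · exact intervalIntegrable_const
  · refine Filter.Eventually.of_forall fun θ _ y hy => ?_
    have h1 : HasFDerivAt (fun y => g (y + circleMap 0 1 θ • v))
      (fderiv ℂ g (y + circleMap 0 1 θ • v)) y := by
      have := (hg (y + circleMap 0 1 θ • v)).hasFDerivAt.comp y
        ((hasFDerivAt_id y).add_const (circleMap 0 1 θ • v))
      rw [ContinuousLinearMap.comp_id] at this
      exact this
    exact h1.const_mul _

theorem nrm_sq (v : Fin 2 → ℝ) : nrm v ^ 2 = v 0 ^ 2 + v 1 ^ 2 :=
  Real.sq_sqrt (by positivity)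

theorem nrm_continuous : Continuous nrm := by
  unfold nrm; fun_prop

theorem nrm_neg (v : Fin 2 → ℝ) : nrm (-v) = nrm v := by
  simp [nrm]

/-- Coordinate projection. -/
def prj (i : Fin 2) : (Fin 2 → ℝ) →L[ℝ] ℝ := ContinuousLinearMap.proj i

theorem prj_apply (i : Fin 2) (v : Fin 2 → ℝ) : prj i v = v i := rfl

theorem hasFDerivAt_coord (i : Fin 2) (v : Fin 2 → ℝ) :
    HasFDerivAt (fun u : Fin 2 → ℝ => u i) (prj i) v := (prj i).hasFDerivAt

/-- Components of the gradient of `w_R`. -/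
def qR (R : ℝ) (i : Fin 2) (v : Fin 2 → ℝ) : ℝ := v i / max (nrm v) R ^ 2

theorem qR_neg (R : ℝ) (i : Fin 2) (v : Fin 2 → ℝ) : qR R i (-v) = -qR R i v := by
  simp [qR, nrm_neg, neg_div]

theorem hasFDerivAt_sq (v : Fin 2 → ℝ) :
    HasFDerivAt (fun u : Fin 2 → ℝ => u 0 ^ 2 + u 1 ^ 2)
      ((2 * v 0) • prj 0 + (2 * v 1) • prj 1) v := by
  have h := ((hasFDerivAt_coord 0 v).pow 2).add ((hasFDerivAt_coord 1 v).pow 2)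
  refine HasFDerivAt.congr_fderiv h ?_
  ext u
  simp [prj_apply]

theorem wR_hasFDerivAt (R : ℝ) (hR : 0 < R) (v : Fin 2 → ℝ) (hv : nrm v ≠ R) :
    HasFDerivAt (wR R) (qR R 0 v • prj 0 + qR R 1 v • prj 1) v := by
  have hs := hasFDerivAt_sq v
  have hn := nrm_sq v
  rcases lt_or_gt_of_ne hv with h | h
  · have he : wR R =ᶠ[nhds v] fun u => Real.log R + ((u 0 ^ 2 + u 1 ^ 2) * (1 / R ^ 2) - 1) * (1 / 2) := by
      filter_upwards [nrm_continuous.continuousAt.eventually_lt continuousAt_const h] with u hu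
      rw [wR, if_neg (not_lt.mpr hu.le), nrm_sq]
      ring
    refine HasFDerivAt.congr_of_eventuallyEq ?_ he
    refine HasFDerivAt.congr_fderiv
      ((((hs.mul_const (1 / R ^ 2)).sub_const 1).mul_const (1 / 2)).const_add (Real.log R)) ?_
    ext u
    simp [prj_apply, qR, max_eq_right h.le]
    ring
  · have he : wR R =ᶠ[nhds v] fun u => Real.log (u 0 ^ 2 + u 1 ^ 2) * (1 / 2) := by
      filter_upwards [continuousAt_const.eventually_lt nrm_continuous.continuousAt h] with u hu
      rw [wR, if_pos hu, nrm, Real.log_sqrt (by positivity)]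
      ring
    have hpos : 0 < v 0 ^ 2 + v 1 ^ 2 := by
      rw [← hn]; have : 0 < nrm v := hR.trans h
      positivity
    refine HasFDerivAt.congr_of_eventuallyEq ?_ he
    refine HasFDerivAt.congr_fderiv ((hs.log hpos.ne').mul_const (1 / 2)) ?_
    ext u
    simp [prj_apply, qR, max_eq_left h.le, hn]
    field_simp

theorem qR_hasFDerivAt (R : ℝ) (hR : 0 < R) (v : Fin 2 → ℝ) (hv : nrm v ≠ R) :
    ∃ a b c : ℝ, HasFDerivAt (qR R 0) (a • prj 0 + b • prj 1) v ∧
      HasFDerivAt (qR R 1) (b • prj 0 + c • prj 1) v ∧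
      a + c = (2 / R ^ 2) * (if nrm v < R then 1 else 0) := by
  have hs := hasFDerivAt_sq v
  have hn := nrm_sq v
  rcases lt_or_gt_of_ne hv with h | h
  · have he : ∀ i, qR R i =ᶠ[nhds v] fun u => u i * (1 / R ^ 2) := by
      intro i
      filter_upwards [nrm_continuous.continuousAt.eventually_lt continuousAt_const h] with u hu
      rw [qR, max_eq_right hu.le]
      ring
    refine ⟨1 / R ^ 2, 0, 1 / R ^ 2, ?_, ?_, ?_⟩
    · refine HasFDerivAt.congr_of_eventuallyEq ?_ (he 0)
      refine HasFDerivAt.congr_fderiv ((hasFDerivAt_coord 0 v).mul_const (1 / R ^ 2)) ?_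
      ext u
      simp [prj_apply]
    · refine HasFDerivAt.congr_of_eventuallyEq ?_ (he 1)
      refine HasFDerivAt.congr_fderiv ((hasFDerivAt_coord 1 v).mul_const (1 / R ^ 2)) ?_
      ext u
      simp [prj_apply]
    · rw [if_pos h]; ring
  · have he : ∀ i, qR R i =ᶠ[nhds v] fun u => u i * (u 0 ^ 2 + u 1 ^ 2)⁻¹ := by
      intro i
      filter_upwards [continuousAt_const.eventually_lt nrm_continuous.continuousAt h] with u hu
      rw [qR, max_eq_left hu.le, nrm_sq, div_eq_mul_inv]
    have hpos : 0 < v 0 ^ 2 + v 1 ^ 2 := by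
      rw [← hn]; have : 0 < nrm v := hR.trans h
      positivity
    refine ⟨(v 1 ^ 2 - v 0 ^ 2) / (v 0 ^ 2 + v 1 ^ 2) ^ 2, -2 * v 0 * v 1 / (v 0 ^ 2 + v 1 ^ 2) ^ 2,
      (v 0 ^ 2 - v 1 ^ 2) / (v 0 ^ 2 + v 1 ^ 2) ^ 2, ?_, ?_, ?_⟩
    · refine HasFDerivAt.congr_of_eventuallyEq ?_ (he 0)
      refine HasFDerivAt.congr_fderiv ((hasFDerivAt_coord 0 v).mul ((hasDerivAt_inv hpos.ne').comp_hasFDerivAt v hs)) ?_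
      ext u
      simp [prj_apply]
      field_simp
      ring
    · refine HasFDerivAt.congr_of_eventuallyEq ?_ (he 1)
      refine HasFDerivAt.congr_fderiv ((hasFDerivAt_coord 1 v).mul ((hasDerivAt_inv hpos.ne').comp_hasFDerivAt v hs)) ?_
      ext u
      simp [prj_apply]
      field_simp
      ring
    · rw [if_neg (not_lt.mpr h.le)]; ring

/-- Gradient of the total superpotential. -/
def GR {N : ℕ} (R : ℝ) (j : Fin N) (i : Fin 2) (x : Conf N) : ℝ :=
  ∑ k ∈ univ.filter (fun k => k ≠ j), qR R i (x j - x k)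

/-- Total superpotential. -/
def om {N : ℕ} (R : ℝ) (y : Conf N) : ℝ :=
  ∑ p ∈ univ.filter (fun p : Fin N × Fin N => p.1 < p.2), wR R (y p.1 - y p.2)

/-- Configurations avoiding the circles. -/
def Good {N : ℕ} (R : ℝ) (x : Conf N) : Prop := ∀ j k : Fin N, j < k → nrm (x j - x k) ≠ R

theorem Good.ne {N : ℕ} {R : ℝ} {x : Conf N} (h : Good R x) {j k : Fin N} (hjk : k ≠ j) :
    nrm (x j - x k) ≠ R := by
  rcases lt_or_gt_of_ne hjk with h1 | h1
  · have := h k j h1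
    rwa [← nrm_neg, neg_sub] at this
  · exact h j k h1

theorem Good.eventually {N : ℕ} {R : ℝ} {x : Conf N} (h : Good R x) :
    ∀ᶠ y in nhds x, Good R y := by
  unfold Good
  rw [Filter.eventually_all]
  intro j
  rw [Filter.eventually_all]
  intro k
  by_cases hjk : j < k
  · have hc : ContinuousAt (fun y : Conf N => nrm (y j - y k)) x :=
      (nrm_continuous.comp (by fun_prop)).continuousAt
    filter_upwards [hc.eventually_ne (h j k hjk)] with y hy _
    exact hy
  · exact Filter.Eventually.of_forall fun y h' => absurd h' hjk

theorem AvecR_zero {N : ℕ} (R : ℝ) (j : Fin N) (x : Conf N) : AvecR R j x 0 = - GR R j 1 x := by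
  simp only [AvecR, GR, qR, perp, Finset.sum_apply, ← Finset.sum_neg_distrib]
  refine Finset.sum_congr rfl fun k _ => ?_
  simp
  ring

theorem AvecR_one {N : ℕ} (R : ℝ) (j : Fin N) (x : Conf N) : AvecR R j x 1 = GR R j 0 x := by
  simp only [AvecR, GR, qR, perp, Finset.sum_apply]
  refine Finset.sum_congr rfl fun k _ => ?_
  simp
  ring

/-- Difference map. -/
def dif {N : ℕ} (j k : Fin N) : Conf N →L[ℝ] (Fin 2 → ℝ) :=
  ContinuousLinearMap.proj (R := ℝ) (φ := fun _ : Fin N => Fin 2 → ℝ) j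
    - ContinuousLinearMap.proj (R := ℝ) (φ := fun _ : Fin N => Fin 2 → ℝ) k

theorem dif_apply {N : ℕ} (j k : Fin N) (x : Conf N) : dif j k x = x j - x k := rfl

theorem hasFDerivAt_dif {N : ℕ} (j k : Fin N) (f : (Fin 2 → ℝ) → ℝ) (x : Conf N)
    (L : (Fin 2 → ℝ) →L[ℝ] ℝ) (h : HasFDerivAt f L (x j - x k)) :
    HasFDerivAt (fun y : Conf N => f (y j - y k)) (L.comp (dif j k)) x :=
  HasFDerivAt.comp x (f := fun y : Conf N => y j - y k) h (dif j k).hasFDerivAt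

theorem om_hasFDerivAt {N : ℕ} (R : ℝ) (hR : 0 < R) (x : Conf N) (hx : Good R x) :
    HasFDerivAt (om R) (∑ p ∈ univ.filter (fun p : Fin N × Fin N => p.1 < p.2),
      (qR R 0 (x p.1 - x p.2) • prj 0 + qR R 1 (x p.1 - x p.2) • prj 1).comp (dif p.1 p.2)) x := by
  unfold om
  refine HasFDerivAt.fun_sum fun p hp => ?_
  refine hasFDerivAt_dif p.1 p.2 (wR R) x _ (wR_hasFDerivAt R hR _ ?_)
  exact hx _ _ (Finset.mem_filter.mp hp).2

theorem om_pdR {N : ℕ} (R : ℝ) (hR : 0 < R) (x : Conf N) (hx : Good R x) (j : Fin N) (i : Fin 2) :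
    pdR j i (om R) x = GR R j i x := by
  unfold pdR
  rw [(om_hasFDerivAt R hR x hx).fderiv]
  have h1 : ∀ p : Fin N × Fin N,
      ((qR R 0 (x p.1 - x p.2) • prj 0 + qR R 1 (x p.1 - x p.2) • prj 1).comp (dif p.1 p.2))
        (evec j i) = (if p.1 = j then qR R i (x p.1 - x p.2) else 0)
          - (if p.2 = j then qR R i (x p.1 - x p.2) else 0) := by
    intro p
    fin_cases i <;> simp [dif_apply, prj_apply, evec, mul_sub]
  rw [_root_.sum_apply, Finset.sum_congr rfl fun p _ => h1 p]
  rw [Finset.sum_filter, Fintype.sum_prod_type]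
  have h2 : ∀ a b : Fin N, (if a < b then (if a = j then qR R i (x a - x b) else 0)
          - (if b = j then qR R i (x a - x b) else 0) else 0)
      = (if a = j then (if j < b then qR R i (x j - x b) else 0) else 0)
        + (if b = j then (if a < j then qR R i (x j - x a) else 0) else 0) := by
    intro a b
    have : qR R i (x a - x b) = - qR R i (x b - x a) := by rw [← qR_neg, neg_sub]
    by_cases h3 : a = j
    · subst h3
      by_cases h4 : b = a
      · subst h4; simp
      · simp [h4]
    · by_cases h4 : b = j
      · subst h4
        simp [h3, this]
      · simp [h3, h4]
  simp only [h2, Finset.sum_add_distrib]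
  rw [Finset.sum_comm]
  simp only [Finset.sum_ite_eq', Finset.mem_univ, if_true]
  rw [GR, Finset.sum_filter, ← Finset.sum_add_distrib]
  refine Finset.sum_congr rfl fun k _ => ?_
  rcases lt_trichotomy j k with h | h | h
  · simp [h, h.ne', not_lt.mpr h.le]
  · simp [h]
  · simp [h, h.ne, not_lt.mpr h.le]

theorem GR_deriv {N : ℕ} (R : ℝ) (hR : 0 < R) (x : Conf N) (hx : Good R x) (j : Fin N) :
    DifferentiableAt ℝ (GR R j 0) x ∧ DifferentiableAt ℝ (GR R j 1) x ∧
    pdR j 0 (GR R j 1) x = pdR j 1 (GR R j 0) x ∧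
    pdR j 0 (GR R j 0) x + pdR j 1 (GR R j 1) x =
      ∑ k ∈ univ.filter (fun k => k ≠ j),
        (2 / R ^ 2) * (if nrm (x j - x k) < R then 1 else 0) := by
  have hex : ∀ k : Fin N, ∃ a b c : ℝ, k ≠ j →
      HasFDerivAt (qR R 0) (a • prj 0 + b • prj 1) (x j - x k) ∧
      HasFDerivAt (qR R 1) (b • prj 0 + c • prj 1) (x j - x k) ∧
      a + c = (2 / R ^ 2) * (if nrm (x j - x k) < R then 1 else 0) := by
    intro k
    by_cases hk : k = j
    · exact ⟨0, 0, 0, fun h => absurd hk h⟩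
    · obtain ⟨a, b, c, h⟩ := qR_hasFDerivAt R hR (x j - x k) (hx.ne hk)
      exact ⟨a, b, c, fun _ => h⟩
  choose a b c h using hex
  have h0 : HasFDerivAt (GR R j 0) (∑ k ∈ univ.filter (fun k => k ≠ j),
      (a k • prj 0 + b k • prj 1).comp (dif j k)) x := by
    unfold GR
    refine HasFDerivAt.fun_sum fun k hk => ?_
    exact hasFDerivAt_dif j k (qR R 0) x _ (h k (Finset.mem_filter.mp hk).2).1
  have h1 : HasFDerivAt (GR R j 1) (∑ k ∈ univ.filter (fun k => k ≠ j),
      (b k • prj 0 + c k • prj 1).comp (dif j k)) x := by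
    unfold GR
    refine HasFDerivAt.fun_sum fun k hk => ?_
    exact hasFDerivAt_dif j k (qR R 1) x _ (h k (Finset.mem_filter.mp hk).2).2.1
  have hev : ∀ s t : ℝ, ∀ k, k ≠ j → ∀ i, ((s • prj 0 + t • prj 1).comp (dif j k)) (evec j i)
      = if i = 0 then s else t := by
    intro s t k hk i
    fin_cases i <;> simp [dif_apply, prj_apply, evec, hk]
  refine ⟨h0.differentiableAt, h1.differentiableAt, ?_, ?_⟩
  · unfold pdR
    rw [h0.fderiv, h1.fderiv, _root_.sum_apply, _root_.sum_apply]
    refine Finset.sum_congr rfl fun k hk => ?_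
    have hk' := (Finset.mem_filter.mp hk).2
    rw [hev _ _ k hk', hev _ _ k hk']
    simp
  · unfold pdR
    rw [h0.fderiv, h1.fderiv, _root_.sum_apply, _root_.sum_apply,
      ← Finset.sum_add_distrib]
    refine Finset.sum_congr rfl fun k hk => ?_
    have hk' := (Finset.mem_filter.mp hk).2
    rw [hev _ _ k hk', hev _ _ k hk', ← (h k hk').2.2]
    simp

theorem pd_mul {N : ℕ} (j : Fin N) (i : Fin 2) (f h : Conf N → ℂ) (x : Conf N)
    (hf : DifferentiableAt ℝ f x) (hh : DifferentiableAt ℝ h x) :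
    pd j i (fun y => f y * h y) x = pd j i f x * h x + f x * pd j i h x := by
  unfold pd
  rw [show (fun y => f y * h y) = f * h from rfl, (hf.hasFDerivAt.mul hh.hasFDerivAt).fderiv]
  simp
  ring

theorem pd_add {N : ℕ} (j : Fin N) (i : Fin 2) (f h : Conf N → ℂ) (x : Conf N)
    (hf : DifferentiableAt ℝ f x) (hh : DifferentiableAt ℝ h x) :
    pd j i (fun y => f y + h y) x = pd j i f x + pd j i h x := by
  unfold pd
  rw [show (fun y => f y + h y) = f + h from rfl, (hf.hasFDerivAt.add hh.hasFDerivAt).fderiv]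
  simp

theorem pd_const_mul {N : ℕ} (j : Fin N) (i : Fin 2) (c : ℂ) (h : Conf N → ℂ) (x : Conf N)
    (hh : DifferentiableAt ℝ h x) :
    pd j i (fun y => c * h y) x = c * pd j i h x := by
  unfold pd
  rw [(hh.hasFDerivAt.const_mul c).fderiv]
  simp

theorem ofReal_diff {N : ℕ} (h : Conf N → ℝ) (x : Conf N)
    (hh : DifferentiableAt ℝ h x) : DifferentiableAt ℝ (fun y => (h y : ℂ)) x :=
  (Complex.ofRealCLM.differentiableAt).comp x hh

theorem pd_ofReal {N : ℕ} (j : Fin N) (i : Fin 2) (h : Conf N → ℝ) (x : Conf N)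
    (hh : DifferentiableAt ℝ h x) :
    pd j i (fun y => (h y : ℂ)) x = (pdR j i h x : ℝ) := by
  unfold pd pdR
  have := (Complex.ofRealCLM.hasFDerivAt).comp x hh.hasFDerivAt
  rw [show (fun y => (h y : ℂ)) = Complex.ofRealCLM ∘ h from rfl, this.fderiv]
  simp

theorem pd_conj {N : ℕ} (j : Fin N) (i : Fin 2) (h : Conf N → ℂ) (x : Conf N)
    (hh : DifferentiableAt ℝ h x) :
    pd j i (fun y => conj (h y)) x = conj (pd j i h x) := by
  unfold pd
  have := (Complex.conjCLE.toContinuousLinearMap.hasFDerivAt).comp x hh.hasFDerivAt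
  rw [show (fun y => conj (h y)) = Complex.conjCLE.toContinuousLinearMap ∘ h from rfl, this.fderiv]
  simp

theorem conj_diff {N : ℕ} (h : Conf N → ℂ) (hh : Differentiable ℝ h) :
    Differentiable ℝ (fun y => conj (h y)) :=
  Complex.conjCLE.toContinuousLinearMap.differentiable.comp hh

theorem pd_congr {N : ℕ} (j : Fin N) (i : Fin 2) (f h : Conf N → ℂ) (x : Conf N)
    (he : f =ᶠ[nhds x] h) : pd j i f x = pd j i h x := by
  unfold pd
  rw [he.fderiv_eq]

/-- Complex coordinates of a configuration as a real-linear map. -/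
def zmap (N : ℕ) : Conf N →L[ℝ] (Fin N → ℂ) :=
  ContinuousLinearMap.pi fun j =>
    (Complex.ofRealCLM.comp (prj 0) + (Complex.I • Complex.ofRealCLM).comp (prj 1)).comp
      (ContinuousLinearMap.proj (R := ℝ) (φ := fun _ : Fin N => Fin 2 → ℝ) j)

theorem zmap_apply {N : ℕ} (x : Conf N) : zmap N x = fun j => zC (x j) := by
  ext j
  simp [zmap, zC, prj_apply]
  ring

theorem zmap_evec0 {N : ℕ} (j : Fin N) : zmap N (evec j 0) = Pi.single j 1 := by
  rw [zmap_apply]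
  ext k
  by_cases h : k = j <;> simp [zC, evec, Pi.single_apply, h]

theorem zmap_evec1 {N : ℕ} (j : Fin N) : zmap N (evec j 1) = Complex.I • Pi.single j 1 := by
  rw [zmap_apply]
  ext k
  by_cases h : k = j <;> simp [zC, evec, Pi.single_apply, h]

theorem hol_hasFDerivAt {N : ℕ} (g : (Fin N → ℂ) → ℂ) (hg : Differentiable ℂ g) (x : Conf N) :
    HasFDerivAt (fun y : Conf N => g (fun j => zC (y j)))
      (((fderiv ℂ g (zmap N x)).restrictScalars ℝ).comp (zmap N)) x := by
  have h1 : (fun y : Conf N => g (fun j => zC (y j))) = g ∘ zmap N := by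
    ext y; simp [zmap_apply]
  rw [h1]
  exact ((hg (zmap N x)).hasFDerivAt.restrictScalars ℝ).comp x (zmap N).hasFDerivAt

theorem hol_pd0 {N : ℕ} (g : (Fin N → ℂ) → ℂ) (hg : Differentiable ℂ g) (x : Conf N) (j : Fin N) :
    pd j 0 (fun y : Conf N => g (fun j => zC (y j))) x
      = fderiv ℂ g (fun j => zC (x j)) (Pi.single j 1) := by
  unfold pd
  rw [(hol_hasFDerivAt g hg x).fderiv]
  simp [zmap_evec0, zmap_apply x]

theorem hol_pd1 {N : ℕ} (g : (Fin N → ℂ) → ℂ) (hg : Differentiable ℂ g) (x : Conf N) (j : Fin N) :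
    pd j 1 (fun y : Conf N => g (fun j => zC (y j))) x
      = Complex.I * fderiv ℂ g (fun j => zC (x j)) (Pi.single j 1) := by
  unfold pd
  rw [(hol_hasFDerivAt g hg x).fderiv]
  simp [zmap_evec1, zmap_apply x]

theorem pd_exp {N : ℕ} (R : ℝ) (hR : 0 < R) (β : ℝ) (j : Fin N) (i : Fin 2) (x : Conf N)
    (hx : Good R x) :
    DifferentiableAt ℝ (fun y : Conf N => (Real.exp (β * om R y) : ℂ)) x ∧
    pd j i (fun y : Conf N => (Real.exp (β * om R y) : ℂ)) x
      = β * GR R j i x * Real.exp (β * om R x) := by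
  have h1 := om_hasFDerivAt R hR x hx
  have h2 := h1.differentiableAt.hasFDerivAt
  have h3 := (h2.const_mul β).exp
  refine ⟨ofReal_diff _ x h3.differentiableAt, ?_⟩
  rw [pd_ofReal _ _ _ _ h3.differentiableAt, pdR, h3.fderiv]
  have h4 := om_pdR R hR x hx j i
  unfold pdR at h4
  simp [h4]
  ring

/-- Core computation for one particle. -/
theorem core {N : ℕ} (R : ℝ) (hR : 0 < R) (α β s : ℝ) (hs : s * s = 1) (hβ : β = s * α)
    (j : Fin N) (F F1 : Conf N → ℂ) (hF : Differentiable ℝ F) (hF1 : Differentiable ℝ F1)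
    (h0 : ∀ y, pd j 0 F y = F1 y) (h1 : ∀ y, pd j 1 F y = s * Complex.I * F1 y)
    (x : Conf N) (h2 : pd j 1 F1 x = s * Complex.I * pd j 0 F1 x) (hx : Good R x) :
    D2R α R j (fun y => (Real.exp (β * om R y) : ℂ) * F y) x
      = -(s * α * (∑ k ∈ univ.filter (fun k => k ≠ j),
        (2 / R ^ 2) * (if nrm (x j - x k) < R then 1 else 0) : ℝ) : ℂ) *
        ((Real.exp (β * om R x) : ℂ) * F x) := by
  have hsc : (s : ℂ) * s = 1 := by exact_mod_cast hs
  have hI := Complex.I_mul_I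
  set K : Conf N → ℂ := fun y => (-Complex.I) * F1 y +
    ((-Complex.I * s * α) * ((GR R j 0 y : ℂ) * F y) + (-α : ℂ) * ((GR R j 1 y : ℂ) * F y)) with hK
  have hD0 : ∀ y, Good R y → DopR α R j 0 (fun y => (Real.exp (β * om R y) : ℂ) * F y) y
      = (Real.exp (β * om R y) : ℂ) * K y := by
    intro y hy
    obtain ⟨e1, e2⟩ := pd_exp R hR β j 0 y hy
    rw [DopR, pd_mul j 0 _ _ y e1 (hF y), e2, h0, AvecR_zero, hK, hβ]
    push_cast
    ring
  have hD1 : ∀ y, Good R y → DopR α R j 1 (fun y => (Real.exp (β * om R y) : ℂ) * F y) y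
      = (s * Complex.I) * ((Real.exp (β * om R y) : ℂ) * K y) := by
    intro y hy
    obtain ⟨e1, e2⟩ := pd_exp R hR β j 1 y hy
    rw [DopR, pd_mul j 1 _ _ y e1 (hF y), e2, h1, AvecR_one, hK, hβ]
    push_cast
    linear_combination (-(Complex.exp (s * α * om R y)) * α * GR R j 0 y * F y) * hsc
      + (s * s * Complex.exp (s * α * om R y) * α * GR R j 0 y * F y) * hI
  obtain ⟨g0, g1, gs, gd⟩ := GR_deriv R hR x hx j
  have g0c := ofReal_diff _ x g0
  have g1c := ofReal_diff _ x g1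
  have d0 : DifferentiableAt ℝ (fun y => (GR R j 0 y : ℂ) * F y) x := g0c.mul (hF x)
  have d1 : DifferentiableAt ℝ (fun y => (GR R j 1 y : ℂ) * F y) x := g1c.mul (hF x)
  have d0' : DifferentiableAt ℝ
      (fun y => (-Complex.I * s * α) * ((GR R j 0 y : ℂ) * F y)) x := d0.const_mul _
  have d1' : DifferentiableAt ℝ
      (fun y => (-α : ℂ) * ((GR R j 1 y : ℂ) * F y)) x := d1.const_mul _
  have dF1 : DifferentiableAt ℝ (fun y => (-Complex.I) * F1 y) x := (hF1 x).const_mul _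
  have hKd : DifferentiableAt ℝ K x := dF1.add (d0'.add d1')
  have hKp : ∀ i, pd j i K x = (-Complex.I) * pd j i F1 x +
      ((-Complex.I * s * α) * ((pdR j i (GR R j 0) x : ℝ) * F x + GR R j 0 x * pd j i F x)
        + (-α : ℂ) * ((pdR j i (GR R j 1) x : ℝ) * F x + GR R j 1 x * pd j i F x)) := by
    intro i
    rw [hK, pd_add j i _ _ x dF1 (d0'.fun_add d1'), pd_add j i _ _ x d0' d1',
      pd_const_mul j i _ _ x (hF1 x), pd_const_mul j i _ _ x d0, pd_const_mul j i _ _ x d1,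
      pd_mul j i _ _ x g0c (hF x), pd_mul j i _ _ x g1c (hF x), pd_ofReal j i _ x g0,
      pd_ofReal j i _ x g1]
  have ev0 : (fun y => DopR α R j 0 (fun y => (Real.exp (β * om R y) : ℂ) * F y) y) =ᶠ[nhds x]
      fun y => (Real.exp (β * om R y) : ℂ) * K y := by
    filter_upwards [hx.eventually] with y hy using hD0 y hy
  have ev1 : (fun y => DopR α R j 1 (fun y => (Real.exp (β * om R y) : ℂ) * F y) y) =ᶠ[nhds x]
      fun y => (s * Complex.I) * ((Real.exp (β * om R y) : ℂ) * K y) := by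
    filter_upwards [hx.eventually] with y hy using hD1 y hy
  obtain ⟨e0, e0p⟩ := pd_exp R hR β j 0 x hx
  obtain ⟨e1, e1p⟩ := pd_exp R hR β j 1 x hx
  have t0 : DopR α R j 0
      (fun y => DopR α R j 0 (fun y => (Real.exp (β * om R y) : ℂ) * F y) y) x
      = (-Complex.I) * (β * GR R j 0 x * Real.exp (β * om R x) * K x
          + Real.exp (β * om R x) * pd j 0 K x)
        - α * GR R j 1 x * (Real.exp (β * om R x) * K x) := by
    rw [DopR, pd_congr j 0 _ _ x ev0, pd_mul j 0 _ _ x e0 hKd, e0p, AvecR_zero]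
    beta_reduce
    rw [hD0 x hx]
    push_cast
    ring
  have t1 : DopR α R j 1
      (fun y => DopR α R j 1 (fun y => (Real.exp (β * om R y) : ℂ) * F y) y) x
      = (s * Complex.I) * ((-Complex.I) * (β * GR R j 1 x * Real.exp (β * om R x) * K x
          + Real.exp (β * om R x) * pd j 1 K x)
        + α * GR R j 0 x * (Real.exp (β * om R x) * K x)) := by
    rw [DopR, pd_congr j 1 _ _ x ev1, pd_const_mul j 1 _ _ x (e1.fun_mul hKd),
      pd_mul j 1 _ _ x e1 hKd, e1p, AvecR_one]
    beta_reduce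
    rw [hD1 x hx]
    push_cast
    ring
  rw [D2R, Fin.sum_univ_two, t0, t1, hKp, hKp, h0, h1, h2, ← gd, gs]
  have hβc : (β : ℂ) = s * α := by rw [hβ]; push_cast; ring
  rw [hβc]
  push_cast
  generalize Complex.exp _ = E
  generalize K x = k
  generalize pd j 0 F1 x = f11
  generalize F1 x = f1
  generalize F x = f
  generalize (GR R j 0 x : ℂ) = G0
  generalize (GR R j 1 x : ℂ) = G1
  generalize ((pdR j 0 (GR R j 0) x : ℝ) : ℂ) = a
  generalize ((pdR j 1 (GR R j 0) x : ℝ) : ℂ) = b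
  generalize ((pdR j 1 (GR R j 1) x : ℝ) : ℂ) = c
  have hss : (s : ℂ) ^ 2 = 1 := by rw [sq]; exact hsc
  have hII : Complex.I ^ 2 = -1 := Complex.I_sq
  generalize Complex.I = i at *
  generalize (s : ℂ) = σ at *
  generalize (α : ℂ) = A at *
  clear * - hss hII
  grind

/-- For `g` holomorphic, `Ψ₊ = e^{-αΣ_{j<k}w_R(x_j-x_k)}·conj(g(z))` and
`Ψ₋ = e^{+αΣ_{j<k}w_R(x_j-x_k)}·g(z)` satisfy `Σ_j D_j² Ψ± = ±α W_R Ψ±` away from the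
circles `|x_j-x_k| = R`. -/
theorem statement2 (N : ℕ) (hN : 1 ≤ N) (α R : ℝ) (hR : 0 < R)
    (g : (Fin N → ℂ) → ℂ) (hg : Differentiable ℂ g) :
    ∀ x : Conf N, (∀ j k : Fin N, j < k → nrm (x j - x k) ≠ R) →
      (∑ j, D2R α R j (fun y =>
          (Real.exp (-α * ∑ p ∈ univ.filter (fun p : Fin N × Fin N => p.1 < p.2),
              wR R (y p.1 - y p.2)) : ℂ)
            * conj (g (fun j => zC (y j)))) x
        = (α * WR R x : ℝ) *
            ((Real.exp (-α * ∑ p ∈ univ.filter (fun p : Fin N × Fin N => p.1 < p.2),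
                wR R (x p.1 - x p.2)) : ℂ) * conj (g (fun j => zC (x j)))))
      ∧ (∑ j, D2R α R j (fun y =>
          (Real.exp (α * ∑ p ∈ univ.filter (fun p : Fin N × Fin N => p.1 < p.2),
              wR R (y p.1 - y p.2)) : ℂ)
            * g (fun j => zC (y j))) x
        = -((α * WR R x : ℝ) : ℂ) *
            ((Real.exp (α * ∑ p ∈ univ.filter (fun p : Fin N × Fin N => p.1 < p.2),
                wR R (x p.1 - x p.2)) : ℂ) * g (fun j => zC (x j)))) := by
  intro x hx
  have hW : ∑ j, ∑ k ∈ univ.filter (fun k => k ≠ j),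
      (2 / R ^ 2) * (if nrm (x j - x k) < R then (1:ℝ) else 0) = WR R x := by
    unfold WR
    simp only [Finset.sum_filter]
    rw [Fintype.sum_prod_type]
    simp only [ne_comm]
  have hd := fun j : Fin N => aux_fderiv_diff g hg (Pi.single j 1)
  constructor
  · have h := fun j : Fin N => core R hR α (-α) (-1) (by norm_num) (by ring) j
      (fun y => conj (g (fun j => zC (y j))))
      (fun y => conj (fderiv ℂ g (fun j => zC (y j)) (Pi.single j 1)))
      (conj_diff _ fun y => (hol_hasFDerivAt g hg y).differentiableAt)
      (conj_diff _ fun y => (hol_hasFDerivAt _ (hd j) y).differentiableAt)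
      (fun y => by
        rw [pd_conj _ _ _ _ (hol_hasFDerivAt g hg y).differentiableAt, hol_pd0 g hg])
      (fun y => by
        rw [pd_conj _ _ _ _ (hol_hasFDerivAt g hg y).differentiableAt, hol_pd1 g hg]
        simp)
      x
      (by
        have e := (hol_hasFDerivAt _ (hd j) x).differentiableAt
        rw [pd_conj _ _ _ _ e, pd_conj _ _ _ _ e, hol_pd1 _ (hd j), hol_pd0 _ (hd j)]
        simp)
      hx
    unfold om at h
    rw [Finset.sum_congr rfl fun j _ => h j, ← Finset.sum_mul, ← hW]
    congr 1
    push_cast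
    rw [Finset.mul_sum]
    exact Finset.sum_congr rfl fun j _ => by ring
  · have h := fun j : Fin N => core R hR α α 1 (by norm_num) (by ring) j
      (fun y => g (fun j => zC (y j)))
      (fun y => fderiv ℂ g (fun j => zC (y j)) (Pi.single j 1))
      (fun y => (hol_hasFDerivAt g hg y).differentiableAt)
      (fun y => (hol_hasFDerivAt _ (hd j) y).differentiableAt)
      (fun y => hol_pd0 g hg y j)
      (fun y => by rw [hol_pd1 g hg]; simp)
      x
      (by
        rw [hol_pd1 _ (hd j), hol_pd0 _ (hd j)]
        simp)
      hx
    unfold om at h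
    rw [Finset.sum_congr rfl fun j _ => h j, ← Finset.sum_mul, ← hW]
    congr 1
    push_cast
    rw [Finset.mul_sum, ← Finset.sum_neg_distrib]
    exact Finset.sum_congr rfl fun j _ => by ring
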